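/- Collaborative double robustness via the e-score (misspecified outcome case): Let m₁ be any bounded measurable function, let g(w) = P(A=1|W=w) be the true propensity score, define r(w) = E[Y − m₁(W) | A=1, g(W) = g(w)] and e(w) = E[g(W) | r(W) = r(w)], assumed bounded below by ε > 0. Then E[(A/e(W))(Y − m₁(W)) + m₁(W) − θ] = 0, where θ = E[E[Y | A=1, W]]. -/

import Mathlib

open MeasureTheory ProbabilityTheory

theorem pull_out_aux {Ω : Type*} {m m0 : MeasurableSpace Ω} (μ : Measure Ω) [IsProbabilityMeasure μ]
    (hle : m ≤ m0) {f k h : Ω → ℝ} (hf : AEStronglyMeasurable[m] f μ)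
    (hfk : Integrable (fun ω => f ω * k ω) μ) (hk : Integrable k μ) (hh : h =ᵐ[μ] μ[k | m]) :
    ∫ ω, f ω * k ω ∂μ = ∫ ω, f ω * h ω ∂μ := by
  have h1 := condExp_mul_of_aestronglyMeasurable_left (m := m) hf hfk hk
  rw [← integral_condExp hle (f := fun ω => f ω * k ω)]
  apply integral_congr_ae
  refine (show μ[fun ω => f ω * k ω | m] =ᵐ[μ] _ from h1).trans ?_
  filter_upwards [hh] with ω h2
  simp [h2]

theorem bdd_int_aux {Ω : Type*} {m0 : MeasurableSpace Ω} (μ : Measure Ω) [IsProbabilityMeasure μ]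
    {f k : Ω → ℝ} (hf : Measurable f) (C : ℝ) (hb : ∀ ω, |f ω| ≤ C) (hk : Integrable k μ) :
    Integrable (fun ω => f ω * k ω) μ :=
  hk.bdd_mul hf.aestronglyMeasurable (Filter.Eventually.of_forall hb)

/-- Collaborative double robustness via the e-score (misspecified outcome case):
with `g(W) = E[A | W]` the true propensity score,
`r(w) = E[Y − m₁(W) | A=1, g(W)=g(w)]` (characterized by
`E[A(Y − m₁(W)) | σ(g(W))] = r(W)·g(W)` since `E[A | σ(g(W))] = g(W)`),
and `e(w) = E[g(W) | r(W)=r(w)]` bounded below by `ε > 0`, one has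
`E[(A/e(W))(Y − m₁(W)) + m₁(W) − θ] = 0` where `θ = E[m(W)]`. -/
theorem escore_collaborative_DR {Ω β : Type*}
    [m0 : MeasurableSpace Ω] [mβ : MeasurableSpace β]
    (μ : Measure Ω) [IsProbabilityMeasure μ]
    (W : Ω → β) (A Y : Ω → ℝ)
    (hW : Measurable W) (hA : Measurable A) (hY : Measurable Y)
    (hA01 : ∀ ω, A ω = 0 ∨ A ω = 1) (hY01 : ∀ ω, Y ω ∈ Set.Icc (0:ℝ) 1)
    (g m : β → ℝ) (hg : Measurable g) (hm : Measurable m)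
    (hmbd : ∀ w, m w ∈ Set.Icc (0:ℝ) 1)
    (ε : ℝ) (hε : 0 < ε) (hgbd : ∀ w, g w ∈ Set.Icc ε 1)
    (hgver : (fun ω => g (W ω)) =ᵐ[μ] μ[A | MeasurableSpace.comap W mβ])
    (hmver : (fun ω => m (W ω) * g (W ω))
      =ᵐ[μ] μ[fun ω => A ω * Y ω | MeasurableSpace.comap W mβ])
    (m₁ : β → ℝ) (hm₁ : Measurable m₁) (C : ℝ) (hm₁bd : ∀ w, |m₁ w| ≤ C)
    (r : β → ℝ) (hr : Measurable r)
    (hrver : (fun ω => r (W ω) * g (W ω)) =ᵐ[μ]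
      μ[fun ω => A ω * (Y ω - m₁ (W ω)) |
        MeasurableSpace.comap (fun ω => g (W ω)) inferInstance])
    (e : β → ℝ) (he : Measurable e) (hebd : ∀ w, e w ∈ Set.Icc ε 1)
    (hever : (fun ω => e (W ω)) =ᵐ[μ]
      μ[fun ω => g (W ω) |
        MeasurableSpace.comap (fun ω => r (W ω)) inferInstance])
    (θ : ℝ) (hθ : θ = ∫ ω, m (W ω) ∂μ) :
    ∫ ω, (A ω / e (W ω) * (Y ω - m₁ (W ω)) + m₁ (W ω) - θ) ∂μ = 0 := by
  have hgW : Measurable (fun ω => g (W ω)) := hg.comp hW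
  have hrW : Measurable (fun ω => r (W ω)) := hr.comp hW
  have heW : Measurable (fun ω => e (W ω)) := he.comp hW
  have hmW : Measurable (fun ω => m (W ω)) := hm.comp hW
  have hm1W : Measurable (fun ω => m₁ (W ω)) := hm₁.comp hW
  have hg0 : ∀ w, 0 < g w := fun w => hε.trans_le (hgbd w).1
  have he0 : ∀ w, 0 < e w := fun w => hε.trans_le (hebd w).1
  have hgi : ∀ w, |(g w)⁻¹| ≤ ε⁻¹ := fun w => by
    rw [abs_of_pos (inv_pos.2 (hg0 w))]
    exact inv_anti₀ hε (hgbd w).1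
  have hei : ∀ w, |(e w)⁻¹| ≤ ε⁻¹ := fun w => by
    rw [abs_of_pos (inv_pos.2 (he0 w))]
    exact inv_anti₀ hε (hebd w).1
  have hAb : ∀ ω, |A ω| ≤ 1 := fun ω => by rcases hA01 ω with h | h <;> simp [h]
  have hYb : ∀ ω, |Y ω| ≤ 1 := fun ω => by
    rw [abs_of_nonneg (hY01 ω).1]; exact (hY01 ω).2
  have iY : Integrable Y μ := by
    simpa using bdd_int_aux μ hY 1 hYb (integrable_const (1:ℝ))
  have iA : Integrable A μ := by
    simpa using bdd_int_aux μ hA 1 hAb (integrable_const (1:ℝ))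
  have im1 : Integrable (fun ω => m₁ (W ω)) μ := by
    simpa using bdd_int_aux μ hm1W C (fun ω => hm₁bd _) (integrable_const (1:ℝ))
  have im : Integrable (fun ω => m (W ω)) μ := by
    simpa using bdd_int_aux μ hmW 1 (fun ω => by
      rw [abs_of_nonneg (hmbd _).1]; exact (hmbd _).2) (integrable_const (1:ℝ))
  have ig : Integrable (fun ω => g (W ω)) μ := by
    simpa using bdd_int_aux μ hgW 1 (fun ω => by
      rw [abs_of_pos (hg0 _)]; exact (hgbd _).2) (integrable_const (1:ℝ))
  have iAY : Integrable (fun ω => A ω * Y ω) μ := bdd_int_aux μ hA 1 hAb iY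
  have iZ : Integrable (fun ω => A ω * (Y ω - m₁ (W ω))) μ :=
    bdd_int_aux μ hA 1 hAb (iY.sub im1)
  have irg : Integrable (fun ω => r (W ω) * g (W ω)) μ :=
    (integrable_congr hrver).2 integrable_condExp
  have ir : Integrable (fun ω => r (W ω)) μ := by
    refine (bdd_int_aux μ hgW.inv ε⁻¹ (fun ω => hgi _) irg).congr (Filter.Eventually.of_forall ?_)
    intro ω
    have := (hg0 (W ω)).ne'
    simp only [Pi.inv_apply]
    field_simp
  have hS : MeasurableSpace.comap W mβ ≤ m0 := hW.comap_le
  have hG : MeasurableSpace.comap (fun ω => g (W ω)) inferInstance ≤ m0 := hgW.comap_le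
  have hR : MeasurableSpace.comap (fun ω => r (W ω)) inferInstance ≤ m0 := hrW.comap_le
  have WS : Measurable[MeasurableSpace.comap W mβ] W := comap_measurable W
  have gG : Measurable[MeasurableSpace.comap (fun ω => g (W ω)) inferInstance]
      (fun ω => g (W ω)) := comap_measurable _
  have rR : Measurable[MeasurableSpace.comap (fun ω => r (W ω)) inferInstance]
      (fun ω => r (W ω)) := comap_measurable _
  have giG : AEStronglyMeasurable[MeasurableSpace.comap (fun ω => g (W ω)) inferInstance]
      (fun ω => (g (W ω))⁻¹) μ := gG.inv.stronglyMeasurable.aestronglyMeasurable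
  -- r is a.e. measurable with respect to g
  have rG : AEStronglyMeasurable[MeasurableSpace.comap (fun ω => g (W ω)) inferInstance]
      (fun ω => r (W ω)) μ := by
    refine ⟨fun ω => (μ[fun ω => A ω * (Y ω - m₁ (W ω)) |
        MeasurableSpace.comap (fun ω => g (W ω)) inferInstance]) ω * (g (W ω))⁻¹,
        stronglyMeasurable_condExp.mul gG.inv.stronglyMeasurable, ?_⟩
    filter_upwards [hrver] with ω h
    rw [← h]
    have := (hg0 (W ω)).ne'
    field_simp
  have eR : AEStronglyMeasurable[MeasurableSpace.comap (fun ω => r (W ω)) inferInstance]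
      (fun ω => e (W ω)) μ := ⟨_, stronglyMeasurable_condExp, hever⟩
  have eG : AEStronglyMeasurable[MeasurableSpace.comap (fun ω => g (W ω)) inferInstance]
      (fun ω => e (W ω)) μ := by
    obtain ⟨e', he', hee'⟩ := eR
    obtain ⟨r', hr', hrr'⟩ := rG
    obtain ⟨φ, hφ, rfl⟩ := he'.measurable.exists_eq_measurable_comp
    refine ⟨φ ∘ r', (hφ.comp hr'.measurable).stronglyMeasurable, ?_⟩
    filter_upwards [hee', hrr'] with ω h1 h2
    rw [h1, Function.comp, Function.comp, h2]
  have einv : ∀ {M : MeasurableSpace Ω}, AEStronglyMeasurable[M] (fun ω => e (W ω)) μ →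
      AEStronglyMeasurable[M] (fun ω => (e (W ω))⁻¹) μ := by
    rintro M ⟨e', he', hee'⟩
    refine ⟨fun ω => (e' ω)⁻¹, he'.measurable.inv.stronglyMeasurable, ?_⟩
    filter_upwards [hee'] with ω h
    rw [h]
  have iEZ : Integrable (fun ω => (e (W ω))⁻¹ * (A ω * (Y ω - m₁ (W ω)))) μ :=
    bdd_int_aux μ heW.inv ε⁻¹ (fun ω => hei _) iZ
  have ha := pull_out_aux μ hG (einv eG) iEZ iZ hrver
  have hb := pull_out_aux μ hR (f := fun ω => (e (W ω))⁻¹ * r (W ω))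
    ((einv eR).mul rR.stronglyMeasurable.aestronglyMeasurable)
    ((bdd_int_aux μ heW.inv ε⁻¹ (fun ω => hei _) irg).congr
      (Filter.Eventually.of_forall fun ω => (mul_assoc _ _ _).symm)) ig hever
  have hc := pull_out_aux μ hG giG (bdd_int_aux μ hgW.inv ε⁻¹ (fun ω => hgi _) iZ) iZ hrver
  have iGAY : Integrable (fun ω => (g (W ω))⁻¹ * (A ω * Y ω)) μ :=
    bdd_int_aux μ hgW.inv ε⁻¹ (fun ω => hgi _) iAY
  have giS : Measurable[MeasurableSpace.comap W mβ] (fun ω => (g (W ω))⁻¹) := (hg.comp WS).inv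
  have m1S : Measurable[MeasurableSpace.comap W mβ] (fun ω => m₁ (W ω)) := hm₁.comp WS
  have hd := pull_out_aux μ hS giS.stronglyMeasurable.aestronglyMeasurable iGAY iAY hmver
  have iGMA : Integrable (fun ω => ((g (W ω))⁻¹ * m₁ (W ω)) * A ω) μ := by
    refine (bdd_int_aux μ hgW.inv ε⁻¹ (fun ω => hgi _)
      (bdd_int_aux μ hm1W C (fun ω => hm₁bd _) iA)).congr
      (Filter.Eventually.of_forall fun ω => (mul_assoc _ _ _).symm)
  have hee := pull_out_aux μ hS (f := fun ω => (g (W ω))⁻¹ * m₁ (W ω))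
    (giS.mul m1S).stronglyMeasurable.aestronglyMeasurable iGMA iA hgver
  have s1 : ∫ ω, (e (W ω))⁻¹ * (r (W ω) * g (W ω)) ∂μ = ∫ ω, r (W ω) ∂μ := by
    simp only [← mul_assoc]
    rw [hb]
    refine integral_congr_ae (Filter.Eventually.of_forall fun ω => ?_)
    have := (he0 (W ω)).ne'
    simp only
    field_simp
  have s2 : ∫ ω, (g (W ω))⁻¹ * (r (W ω) * g (W ω)) ∂μ = ∫ ω, r (W ω) ∂μ := by
    refine integral_congr_ae (Filter.Eventually.of_forall fun ω => ?_)
    have := (hg0 (W ω)).ne'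
    simp only
    field_simp
  have s3 : ∫ ω, (g (W ω))⁻¹ * (m (W ω) * g (W ω)) ∂μ = ∫ ω, m (W ω) ∂μ := by
    refine integral_congr_ae (Filter.Eventually.of_forall fun ω => ?_)
    have := (hg0 (W ω)).ne'
    simp only
    field_simp
  have s4 : ∫ ω, (g (W ω))⁻¹ * m₁ (W ω) * g (W ω) ∂μ = ∫ ω, m₁ (W ω) ∂μ := by
    refine integral_congr_ae (Filter.Eventually.of_forall fun ω => ?_)
    have := (hg0 (W ω)).ne'
    simp only
    field_simp
  have s5 : ∫ ω, (g (W ω))⁻¹ * (A ω * (Y ω - m₁ (W ω))) ∂μ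
      = ∫ ω, (g (W ω))⁻¹ * (A ω * Y ω) ∂μ - ∫ ω, (g (W ω))⁻¹ * m₁ (W ω) * A ω ∂μ := by
    rw [← integral_sub iGAY iGMA]
    refine integral_congr_ae (Filter.Eventually.of_forall fun ω => ?_)
    simp only
    ring
  have s6 : ∫ ω, (A ω / e (W ω) * (Y ω - m₁ (W ω)) + m₁ (W ω) - θ) ∂μ
      = ∫ ω, (e (W ω))⁻¹ * (A ω * (Y ω - m₁ (W ω))) ∂μ + ∫ ω, m₁ (W ω) ∂μ - θ := by
    have : ∫ _ω : Ω, θ ∂μ = θ := by simp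
    conv_rhs => rw [← this]
    rw [← integral_add iEZ im1, ← integral_sub (by exact iEZ.add im1) (integrable_const θ)]
    refine integral_congr_ae (Filter.Eventually.of_forall fun ω => ?_)
    simp only
    ring
  rw [s6, hθ]
  linarith
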